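/- arXiv:2511.06461 — 10 statements merged into one kernel-verified Lean document; each statement's English description precedes it below -/
import Mathlib

section
/- Let X be a metric space, let ε, δ ≥ 0, let S ⊆ X be a nonempty set with diam(S) ≤ (2+ε)·δ, and let q ∈ X. Define r := (1+ε)·inf_{s∈S} dist(q,s) + δ. Then every s ∈ S satisfies dist(q,s) ≤ (1+ε)·r + δ and r ≤ (1+ε)·dist(q,s) + δ; in particular, S ⊆ Φ(q,r). -/
/-- Let `X` be a metric space, `ε, δ ≥ 0`, `S ⊆ X` a nonempty set with
`diam S ≤ (2+ε)·δ` (i.e. all pairwise distances in `S` are at most `(2+ε)·δ`), and `q ∈ X`.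
With `r := (1+ε)·inf_{s∈S} dist(q,s) + δ`, every `s ∈ S` satisfies
`dist(q,s) ≤ (1+ε)·r + δ` and `r ≤ (1+ε)·dist(q,s) + δ`; in particular `S ⊆ Φ(q,r)`. -/
theorem stmt0 {X : Type*} [MetricSpace X] (ε δ : ℝ) (hε : 0 ≤ ε) (hδ : 0 ≤ δ)
    (S : Set X) (hS : S.Nonempty)
    (hdiam : ∀ x ∈ S, ∀ y ∈ S, dist x y ≤ (2 + ε) * δ)
    (q : X) (r : ℝ) (hr : r = (1 + ε) * (⨅ s : S, dist q (s : X)) + δ) :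
    ∀ s ∈ S, dist q s ≤ (1 + ε) * r + δ ∧ r ≤ (1 + ε) * dist q s + δ := by
  have : Nonempty S := hS.to_subtype
  have hbdd : BddBelow (Set.range fun s : S => dist q (s : X)) :=
    ⟨0, by rintro _ ⟨s, rfl⟩; exact dist_nonneg⟩
  intro s hs
  have hle : (⨅ t : S, dist q (t : X)) ≤ dist q s := ciInf_le hbdd ⟨s, hs⟩
  have hnonneg : 0 ≤ ⨅ t : S, dist q (t : X) := Real.iInf_nonneg fun _ => dist_nonneg
  have hge : dist q s - (2 + ε) * δ ≤ ⨅ t : S, dist q (t : X) :=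
    le_ciInf fun t => by
      linarith [dist_triangle q (t : X) s, hdiam t t.2 s hs]
  set m := ⨅ t : S, dist q (t : X)
  subst hr
  constructor
  · nlinarith [mul_nonneg hε hnonneg, mul_nonneg (mul_nonneg hε hε) hnonneg]
  · gcongr
end

section
/- Let X be a metric space, let ε, δ ≥ 0 and α > 0, and let N ⊆ X be an α-cover of X, i.e. for every x ∈ X there exists q ∈ N with dist(x,q) ≤ α. Let r : N → ℝ be any assignment of responses. If two points A, B ∈ X satisfy A ∈ Φ(q, r(q)) and B ∈ Φ(q, r(q)) for every q ∈ N, then dist(A,B) ≤ (2+ε)·δ + ((1+ε)² + 1)·α. -/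
/-- Let `X` be a metric space, `ε, δ ≥ 0`, `α > 0`, and let `N ⊆ X` be an
`α`-cover of `X`. Let `r : X → ℝ` assign responses to the queries in `N`. If two points
`A, B ∈ X` lie in the feasible region `Φ(q, r q)` for every `q ∈ N`, then
`dist(A,B) ≤ (2+ε)·δ + ((1+ε)² + 1)·α`. -/
theorem stmt1 {X : Type*} [MetricSpace X] (ε δ α : ℝ) (hε : 0 ≤ ε) (hδ : 0 ≤ δ)
    (hα : 0 < α) (N : Set X) (hcover : ∀ x : X, ∃ q ∈ N, dist x q ≤ α)
    (r : X → ℝ) (A B : X)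
    (hA : ∀ q ∈ N, dist A q ≤ (1 + ε) * r q + δ ∧ r q ≤ (1 + ε) * dist A q + δ)
    (hB : ∀ q ∈ N, dist B q ≤ (1 + ε) * r q + δ ∧ r q ≤ (1 + ε) * dist B q + δ) :
    dist A B ≤ (2 + ε) * δ + ((1 + ε) ^ 2 + 1) * α := by
  obtain ⟨q, hq, hAq⟩ := hcover A
  have hr : r q ≤ (1 + ε) * α + δ :=
    (hA q hq).2.trans (by gcongr)
  have hBq : dist B q ≤ (1 + ε) * ((1 + ε) * α + δ) + δ :=
    (hB q hq).1.trans (by gcongr)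
  have htri := dist_triangle_right A B q
  linarith
end

section
/- Let X be a nonempty compact metric space. Then the diameter-radius profile e_X is right-continuous on [0,∞): for every α ≥ 0, e_X(β) tends to e_X(α) as β tends to α from the right (along β > α). -/
/-- The Chebyshev radius of a subset `S` of a metric space `X`:
`r(S) := inf_{q ∈ X} sup_{x ∈ S} dist(x,q)`. -/
noncomputable def chebRadius (X : Type*) [MetricSpace X] (S : Set X) : ℝ :=
  ⨅ q : X, ⨆ x : S, dist (x : X) q

/-- The diameter-radius profile of `X`:
`e_X(α) := sup { r(S) : S ⊆ X nonempty with diam(S) ≤ α }`. -/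
noncomputable def diamRadiusProfile (X : Type*) [MetricSpace X] (α : ℝ) : ℝ :=
  sSup { r : ℝ | ∃ S : Set X, S.Nonempty ∧ (∀ x ∈ S, ∀ y ∈ S, dist x y ≤ α) ∧
    r = chebRadius X S }

section ChebyshevRadius

variable {X : Type*} [MetricSpace X]

theorem chebRadius_le_iSup_dist (S : Set X) (q : X) :
    chebRadius X S ≤ ⨆ x : S, dist (x : X) q :=
  ciInf_le ⟨0, by
    rintro _ ⟨p, rfl⟩
    exact Real.iSup_nonneg fun _ => dist_nonneg⟩ q

theorem diamRadiusProfile_le [Nonempty X] {α c : ℝ} (hα : 0 ≤ α)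
    (h : ∀ S : Set X, S.Nonempty → (∀ x ∈ S, ∀ y ∈ S, dist x y ≤ α) → chebRadius X S ≤ c) :
    diamRadiusProfile X α ≤ c := by
  refine csSup_le ⟨_, {Classical.arbitrary X}, Set.singleton_nonempty _, ?_, rfl⟩ ?_
  · rintro x rfl y rfl
    simpa using hα
  · rintro _ ⟨S, hS, hd, rfl⟩
    exact h S hS hd

variable [CompactSpace X]

theorem bddAbove_range_dist_subtype (S : Set X) (q : X) :
    BddAbove (Set.range fun x : S => dist (x : X) q) :=
  ⟨Metric.diam (Set.univ : Set X), by
    rintro _ ⟨x, rfl⟩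
    exact Metric.dist_le_diam_of_mem isCompact_univ.isBounded trivial trivial⟩

/-- If every point of `S` is within distance `ε` of `T`, then `r(S) ≤ r(T) + ε`. -/
theorem chebRadius_le_add_of_forall_exists_dist_le [Nonempty X] {S T : Set X} {ε : ℝ}
    (hS : S.Nonempty) (h : ∀ x ∈ S, ∃ y ∈ T, dist x y ≤ ε) :
    chebRadius X S ≤ chebRadius X T + ε := by
  rw [← sub_le_iff_le_add]
  refine le_ciInf fun q => ?_
  rw [sub_le_iff_le_add]
  have := hS.to_subtype
  refine (chebRadius_le_iSup_dist S q).trans (ciSup_le fun x => ?_)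
  obtain ⟨y, hy, hxy⟩ := h x x.2
  have hyq := le_ciSup (bddAbove_range_dist_subtype T q) ⟨y, hy⟩
  have := dist_triangle (x : X) y q
  dsimp only at hyq
  linarith

theorem chebRadius_le_diam_univ [Nonempty X] {S : Set X} (hS : S.Nonempty) :
    chebRadius X S ≤ Metric.diam (Set.univ : Set X) := by
  have := hS.to_subtype
  exact (chebRadius_le_iSup_dist S (Classical.arbitrary X)).trans <| ciSup_le fun x =>
    Metric.dist_le_diam_of_mem isCompact_univ.isBounded trivial trivial

theorem chebRadius_le_diamRadiusProfile [Nonempty X] {S : Set X} {α : ℝ} (hS : S.Nonempty)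
    (h : ∀ x ∈ S, ∀ y ∈ S, dist x y ≤ α) : chebRadius X S ≤ diamRadiusProfile X α :=
  le_csSup ⟨Metric.diam (Set.univ : Set X), by
    rintro _ ⟨T, hT, -, rfl⟩
    exact chebRadius_le_diam_univ hT⟩ ⟨S, hS, h, rfl⟩

theorem diamRadiusProfile_mono [Nonempty X] {α β : ℝ} (hα : 0 ≤ α) (h : α ≤ β) :
    diamRadiusProfile X α ≤ diamRadiusProfile X β :=
  diamRadiusProfile_le hα fun _ hS hd =>
    chebRadius_le_diamRadiusProfile hS fun x hx y hy => (hd x hx y hy).trans h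

/-- In a compact space, sets of diameter slightly above `α` lie close to
nonempty sets of diameter at most `α`. -/
theorem exists_gt_forall_exists_near_of_dist_le {α ε : ℝ} (hα : 0 ≤ α) (hε : 0 < ε) :
    ∃ β > α, ∀ S : Set X, S.Nonempty → (∀ x ∈ S, ∀ y ∈ S, dist x y ≤ β) →
      ∃ T : Set X, T.Nonempty ∧ (∀ x ∈ T, ∀ y ∈ T, dist x y ≤ α) ∧
        ∀ x ∈ S, ∃ y ∈ T, dist x y ≤ ε := by
  by_contra! H
  obtain ⟨u, -, hu, hu'⟩ := exists_seq_strictAnti_tendsto α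
  choose S hS hd hfar using fun n => H (u n) (hu n)
  let K : ℕ → TopologicalSpace.NonemptyCompacts X := fun n =>
    ⟨⟨closure (S n), isClosed_closure.isCompact⟩, (hS n).closure⟩
  have hKd (n : ℕ) : ∀ x ∈ K n, ∀ y ∈ K n, dist x y ≤ u n := fun x hx y hy =>
    calc dist x y ≤ Metric.diam (closure (S n)) :=
          Metric.dist_le_diam_of_mem isClosed_closure.isCompact.isBounded hx hy
      _ = Metric.diam (S n) := Metric.diam_closure _
      _ ≤ u n := Metric.diam_le_of_forall_dist_le (hα.trans (hu n).le) (hd n)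
  obtain ⟨L, φ, hφ, hL⟩ := CompactSpace.tendsto_subseq K
  have near {η : ℝ} (hη : 0 < η) : ∀ᶠ n in Filter.atTop,
      Metric.hausdorffDist (K (φ n) : Set X) L < η := (Metric.tendsto_nhds.1 hL) η hη
  have fin (n : ℕ) : Metric.hausdorffEDist (K n : Set X) L ≠ ⊤ :=
    Metric.hausdorffEDist_ne_top_of_nonempty_of_bounded (K n).nonempty L.nonempty
      (K n).isCompact.isBounded L.isCompact.isBounded
  have hLd : ∀ x ∈ (L : Set X), ∀ y ∈ (L : Set X), dist x y ≤ α := by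
    intro x hx y hy
    refine le_of_forall_pos_le_add fun η hη => ?_
    obtain ⟨n, hn, hun⟩ := ((near (show 0 < η / 3 by positivity)).and
      ((hu'.comp hφ.tendsto_atTop).eventually_lt_const
        (show α < α + η / 3 by linarith))).exists
    obtain ⟨x', hx', hxx⟩ := Metric.exists_dist_lt_of_hausdorffDist_lt' hx hn (fin _)
    obtain ⟨y', hy', hyy⟩ := Metric.exists_dist_lt_of_hausdorffDist_lt' hy hn (fin _)
    have h1 := hKd _ x' hx' y' hy'
    have h2 := dist_triangle4 x x' y' y
    rw [dist_comm] at hxx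
    dsimp only [Function.comp_apply] at hun
    linarith
  obtain ⟨n, hn⟩ := (near hε).exists
  obtain ⟨x, hx, hxL⟩ := hfar (φ n) L L.nonempty hLd
  obtain ⟨y, hy, hxy⟩ := Metric.exists_dist_lt_of_hausdorffDist_lt
    (show x ∈ (K (φ n) : Set X) from subset_closure hx) hn (fin _)
  exact (hxL y hy).not_gt hxy

end ChebyshevRadius

/-- If `X` is a nonempty compact metric space, then the diameter-radius
profile `e_X` is right-continuous on `[0,∞)`: for every `α ≥ 0`, `e_X(β) → e_X(α)` as
`β → α` from the right. -/
theorem stmt5 (X : Type*) [MetricSpace X] [CompactSpace X] [Nonempty X]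
    (α : ℝ) (hα : 0 ≤ α) :
    Filter.Tendsto (fun β => diamRadiusProfile X β)
      (nhdsWithin α (Set.Ioi α)) (nhds (diamRadiusProfile X α)) := by
  rw [Metric.tendsto_nhds]
  intro ε hε
  obtain ⟨β, hβ, H⟩ :=
    exists_gt_forall_exists_near_of_dist_le (X := X) hα (half_pos hε)
  filter_upwards [Ioo_mem_nhdsGT hβ] with γ hγ
  have h1 := diamRadiusProfile_mono (X := X) hα hγ.1.le
  have h2 : diamRadiusProfile X γ ≤ diamRadiusProfile X α + ε / 2 := by
    refine diamRadiusProfile_le (hα.trans hγ.1.le) fun S hS hd => ?_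
    obtain ⟨T, hT, hTd, hST⟩ := H S hS fun x hx y hy => (hd x hx y hy).trans hγ.2.le
    exact (chebRadius_le_add_of_forall_exists_dist_le hS hST).trans
      (add_le_add_left (chebRadius_le_diamRadiusProfile hT hTd) _)
  rw [Real.dist_eq, abs_of_nonneg (sub_nonneg.2 h1)]
  linarith
end

section
/- Let E be the n-dimensional Euclidean space ℝⁿ (n ≥ 1), let ε, δ ≥ 0, let S ⊆ E be a nonempty bounded set and q ∈ E. Set ρ_min := inf_{s∈S} dist(s,q), ρ_max := sup_{s∈S} dist(s,q), α* := ((1+ε)²·ρ_min − ρ_max + (2+ε)·δ) / ((1+ε)² + 1), and r* := ((1+ε)·(ρ_min + ρ_max) − ε·δ) / (1 + (1+ε)²). If α* > 0, then the α*-neighborhood S_{α*} is contained in the feasible region Φ(q, r*); that is, every y ∈ E with dist(y,s) ≤ α* for some s ∈ S satisfies dist(y,q) ≤ (1+ε)·r* + δ and r* ≤ (1+ε)·dist(y,q) + δ. -/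
/-- In Euclidean space `ℝⁿ` (`n ≥ 1`), with `ε, δ ≥ 0`, a nonempty
bounded set `S` and query point `q`, set `ρ_min := inf_{s∈S} dist(s,q)`,
`ρ_max := sup_{s∈S} dist(s,q)`,
`α* := ((1+ε)²·ρ_min − ρ_max + (2+ε)·δ)/((1+ε)² + 1)` and
`r* := ((1+ε)·(ρ_min + ρ_max) − ε·δ)/(1 + (1+ε)²)`.  If `α* > 0`, then the
`α*`-neighborhood of `S` is contained in the feasible region `Φ(q, r*)`. -/
theorem stmt10 (n : ℕ) (hn : 1 ≤ n) (ε δ : ℝ) (hε : 0 ≤ ε) (hδ : 0 ≤ δ)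
    (S : Set (EuclideanSpace ℝ (Fin n))) (hS : S.Nonempty)
    (hbdd : Bornology.IsBounded S) (q : EuclideanSpace ℝ (Fin n))
    (ρmin ρmax αstar rstar : ℝ)
    (hρmin : ρmin = ⨅ s : S, dist (s : EuclideanSpace ℝ (Fin n)) q)
    (hρmax : ρmax = ⨆ s : S, dist (s : EuclideanSpace ℝ (Fin n)) q)
    (hαstar : αstar = ((1 + ε) ^ 2 * ρmin - ρmax + (2 + ε) * δ) / ((1 + ε) ^ 2 + 1))
    (hrstar : rstar = ((1 + ε) * (ρmin + ρmax) - ε * δ) / (1 + (1 + ε) ^ 2))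
    (hαpos : 0 < αstar) :
    ∀ y : EuclideanSpace ℝ (Fin n), (∃ s ∈ S, dist y s ≤ αstar) →
      dist y q ≤ (1 + ε) * rstar + δ ∧ rstar ≤ (1 + ε) * dist y q + δ := by
  rintro y ⟨s, hs, hys⟩
  have hD : 1 + (1 + ε) ^ 2 ≠ 0 := by positivity
  have hD' : (1 + ε) ^ 2 + 1 ≠ 0 := by positivity
  have hmin : ρmin ≤ dist s q := by
    rw [hρmin]
    exact ciInf_le (f := fun s : S => dist (s : EuclideanSpace ℝ (Fin n)) q)
      ⟨0, by rintro _ ⟨x, rfl⟩; exact dist_nonneg⟩ ⟨s, hs⟩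
  have hmax : dist s q ≤ ρmax := by
    obtain ⟨R, hR⟩ := hbdd.subset_closedBall q
    rw [hρmax]
    exact le_ciSup (f := fun s : S => dist (s : EuclideanSpace ℝ (Fin n)) q)
      ⟨R, by rintro _ ⟨x, rfl⟩; exact hR x.2⟩ ⟨s, hs⟩
  have hupper : αstar + ρmax = (1 + ε) * rstar + δ := by
    rw [hαstar, hrstar]
    field_simp
    ring
  have hlower : (1 + ε) * (ρmin - αstar) + δ = rstar := by
    rw [hαstar, hrstar]
    field_simp
    ring
  constructor
  · linarith [dist_triangle y s q]
  · have hdist : ρmin - αstar ≤ dist y q := by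
      linarith [dist_triangle_left s q y]
    rw [← hlower]
    gcongr
end

section
/- Let E be a finite-dimensional real inner product space and let A, B, q ∈ E be points with A ≠ B and dist(q,B) ≤ dist(q,A). Then dist(q,A) − dist(q,B) ≤ dist(A,B)·cos(∠ q A B), where ∠ q A B denotes the (Euclidean) angle at the vertex A between the points q and B. -/
/-- Let `E` be a finite-dimensional real inner product space and
`A, B, q ∈ E` points with `A ≠ B` and `dist(q,B) ≤ dist(q,A)`.  Then
`dist(q,A) − dist(q,B) ≤ dist(A,B) · cos(∠ q A B)`, where `∠ q A B` is the angle at `A`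
between `q` and `B`. -/
theorem stmt11 {E : Type*} [NormedAddCommGroup E] [InnerProductSpace ℝ E]
    [FiniteDimensional ℝ E] (A B q : E) (hAB : A ≠ B)
    (hdist : dist q B ≤ dist q A) :
    dist q A - dist q B ≤ dist A B * Real.cos (EuclideanGeometry.angle q A B) := by
  have hqA : 0 < dist q A := by
    refine dist_pos.2 fun h => hAB ?_
    rw [h, dist_self] at hdist
    exact dist_le_zero.1 hdist
  have hcos := EuclideanGeometry.law_cos q A B
  rw [dist_comm B A] at hcos
  have htri : dist q A ≤ dist q B + dist A B := by
    simpa [dist_comm A B] using dist_triangle q B A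
  have hsq : (dist q A - dist q B) ^ 2 ≤ dist A B ^ 2 :=
    pow_le_pow_left₀ (sub_nonneg.2 hdist) (by linarith) 2
  refine le_of_mul_le_mul_left ?_ hqA
  linarith
end

section
/- Let n ≥ 1, let δ > α > 0, and let Δ ⊆ ℝⁿ be a regular simplex of edge length 2δ (a set of n+1 points pairwise at distance 2δ). Let q ∈ ℝⁿ, let A ∈ Δ be a vertex with dist(q,A) = max_{V∈Δ} dist(q,V), and let B ∈ Δ be a vertex with dist(q,B) = min_{V∈Δ} dist(q,V). If cos(∠ B A q) ≤ 1 − α/δ, then with r* := (dist(q,A) + dist(q,B))/2, every point x of the α-neighborhood Δ_α satisfies |dist(x,q) − r*| ≤ δ. -/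
/-- Let `n ≥ 1`, `δ > α > 0`, and let `Δ ⊆ ℝⁿ` be a regular simplex
with `n+1` vertices `V 0, …, V n`, pairwise at distance `2δ`.  Let `q ∈ ℝⁿ`, let
`A = V iA` be a farthest vertex from `q` and `B = V iB` a nearest vertex.  If
`cos(∠ B A q) ≤ 1 − α/δ`, then with `r* := (dist(q,A) + dist(q,B))/2`, every point `x`
of the `α`-neighborhood of `Δ` satisfies `|dist(x,q) − r*| ≤ δ`. -/
theorem stmt12 (n : ℕ) (hn : 1 ≤ n) (δ α : ℝ) (hα : 0 < α) (hαδ : α < δ)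
    (V : Fin (n + 1) → EuclideanSpace ℝ (Fin n))
    (hV : ∀ i j, i ≠ j → dist (V i) (V j) = 2 * δ)
    (q : EuclideanSpace ℝ (Fin n)) (iA iB : Fin (n + 1))
    (hfar : ∀ i, dist q (V i) ≤ dist q (V iA))
    (hnear : ∀ i, dist q (V iB) ≤ dist q (V i))
    (hangle : Real.cos (EuclideanGeometry.angle (V iB) (V iA) q) ≤ 1 - α / δ) :
    ∀ x : EuclideanSpace ℝ (Fin n), (∃ i, dist x (V i) ≤ α) →
      |dist x q - (dist q (V iA) + dist q (V iB)) / 2| ≤ δ := by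
  have hδ : 0 < δ := hα.trans hαδ
  have gap : dist q (V iA) - dist q (V iB) ≤ 2 * (δ - α) := by
    by_cases hAB : iB = iA
    · subst hAB
      linarith
    · have hcos := EuclideanGeometry.law_cos (V iB) (V iA) q
      rw [hV iB iA hAB, dist_comm (V iB) q] at hcos
      have ha : 0 ≤ dist q (V iA) := dist_nonneg
      have hb : 0 ≤ dist q (V iB) := dist_nonneg
      set a := dist q (V iA)
      set b := dist q (V iB)
      set c := Real.cos (EuclideanGeometry.angle (V iB) (V iA) q)
      have hc : δ * c ≤ δ - α := by
        calc δ * c ≤ δ * (1 - α / δ) := by gcongr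
          _ = δ - α := by field_simp
      have hac : a * (δ * c) ≤ a * (δ - α) := by gcongr
      have hsq : (a - 2 * (δ - α)) ^ 2 ≤ b ^ 2 := by
        nlinarith [mul_pos hα hδ, mul_pos hα (sub_pos.2 hαδ)]
      linarith [le_of_abs_le (abs_le_of_sq_le_sq hsq hb)]
  rintro x ⟨i, hi⟩
  have h₁ : dist x q ≤ dist x (V i) + dist q (V i) := dist_triangle_right x q (V i)
  have h₂ : dist q (V i) ≤ dist x q + dist x (V i) := by
    simpa [dist_comm] using dist_triangle q x (V i)
  have h₃ := hfar i
  have h₄ := hnear i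
  rw [abs_le]
  constructor <;> linarith
end

section
/- Let n ≥ 1, ε > 0, δ > 0, and let Δ ⊆ ℝⁿ be a regular simplex of edge length (2+ε)·δ. Let α satisfy 0 < 4α ≤ (2+ε)·δ, let q ∈ ℝⁿ be any point, and set α' := ((1+ε)² − 1)/(2·(1+ε)²) · α. Then there exist a regular simplex Δ' ⊆ ℝⁿ of edge length (2+ε)·δ and a response r ∈ ℝ such that Δ'_{α'} ⊆ Δ_α and Δ'_{α'} ⊆ Φ(q,r), i.e. every x ∈ Δ'_{α'} satisfies dist(x,q) ≤ (1+ε)·r + δ and r ≤ (1+ε)·dist(x,q) + δ. -/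
/-- Any vector of a nontrivial space can be lengthened to a prescribed norm `β ≥ ‖v‖` by adding a
vector of norm at most `β`. -/
lemma exists_norm_le_norm_add_eq {E : Type*} [NormedAddCommGroup E] [NormedSpace ℝ E]
    [Nontrivial E] (v : E) {β : ℝ} (hv : ‖v‖ ≤ β) : ∃ t : E, ‖t‖ ≤ β ∧ ‖v + t‖ = β := by
  have hβ : 0 ≤ β := (norm_nonneg v).trans hv
  rcases eq_or_ne v 0 with rfl | hv0
  · obtain ⟨t, ht⟩ := exists_norm_eq E hβ
    exact ⟨t, ht.le, by rw [zero_add, ht]⟩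
  · have hpos : 0 < ‖v‖ := norm_pos_iff.mpr hv0
    refine ⟨((β - ‖v‖) / ‖v‖) • v, ?_, ?_⟩
    · rw [norm_smul, Real.norm_of_nonneg (div_nonneg (sub_nonneg.mpr hv) hpos.le),
        div_mul_cancel₀ _ hpos.ne']
      linarith
    · have h : v + ((β - ‖v‖) / ‖v‖) • v = (β / ‖v‖) • v := by
        rw [sub_div, div_self hpos.ne', sub_smul, one_smul, add_sub_cancel]
      rw [h, norm_smul, Real.norm_of_nonneg (div_nonneg hβ hpos.le), div_mul_cancel₀ _ hpos.ne']

/-- A family of points with pairwise distances `d ≥ 2β` can be translated by a vector of norm at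
most `β` so that every point is at distance at least `β` from `q`. -/
lemma exists_translate_le_dist {E ι : Type*} [NormedAddCommGroup E] [NormedSpace ℝ E]
    [Nontrivial E] (V : ι → E) {d β : ℝ} (hβ : 0 ≤ β) (hd : 2 * β ≤ d)
    (hV : ∀ i j, i ≠ j → dist (V i) (V j) = d) (q : E) :
    ∃ t : E, ‖t‖ ≤ β ∧ ∀ i, β ≤ dist (V i + t) q := by
  by_cases h : ∀ i, β ≤ dist (V i) q
  · exact ⟨0, by simpa using hβ, by simpa using h⟩
  · push Not at h
    obtain ⟨i, hi⟩ := h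
    rw [dist_eq_norm] at hi
    obtain ⟨t, ht, hti⟩ := exists_norm_le_norm_add_eq (V i - q) hi.le
    have hi' : dist (V i + t) q = β := by
      rw [dist_eq_norm, ← hti]
      congr 1
      abel
    refine ⟨t, ht, fun j => ?_⟩
    rcases eq_or_ne i j with rfl | hij
    · exact hi'.ge
    · have h1 := dist_triangle_right (V i + t) (V j + t) q
      rw [dist_add_right, hV i j hij] at h1
      linarith


/-- Let `n ≥ 1`, `ε > 0`, `δ > 0`, and let `Δ ⊆ ℝⁿ` be a regular
simplex with vertices `V 0, …, V n` pairwise at distance `(2+ε)·δ`.  Let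
`0 < 4α ≤ (2+ε)·δ`, let `q ∈ ℝⁿ`, and set `α' := ((1+ε)² − 1)/(2(1+ε)²) · α`.  Then
there are a regular simplex `Δ'` of the same edge length (with vertices `V'`) and a
response `r ∈ ℝ` such that `Δ'_{α'} ⊆ Δ_α` and `Δ'_{α'} ⊆ Φ(q,r)`. -/
theorem stmt15 (n : ℕ) (hn : 1 ≤ n) (ε δ : ℝ) (hε : 0 < ε) (hδ : 0 < δ)
    (V : Fin (n + 1) → EuclideanSpace ℝ (Fin n))
    (hV : ∀ i j, i ≠ j → dist (V i) (V j) = (2 + ε) * δ)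
    (α : ℝ) (hα0 : 0 < α) (hα : 4 * α ≤ (2 + ε) * δ)
    (q : EuclideanSpace ℝ (Fin n))
    (α' : ℝ) (hα' : α' = ((1 + ε) ^ 2 - 1) / (2 * (1 + ε) ^ 2) * α) :
    ∃ (V' : Fin (n + 1) → EuclideanSpace ℝ (Fin n)) (r : ℝ),
      (∀ i j, i ≠ j → dist (V' i) (V' j) = (2 + ε) * δ) ∧
      (∀ x : EuclideanSpace ℝ (Fin n),
        (∃ i, dist x (V' i) ≤ α') → (∃ i, dist x (V i) ≤ α)) ∧
      (∀ x : EuclideanSpace ℝ (Fin n), (∃ i, dist x (V' i) ≤ α') →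
        dist x q ≤ (1 + ε) * r + δ ∧ r ≤ (1 + ε) * dist x q + δ) := by
  have : NeZero n := ⟨by omega⟩
  set k : ℝ := (1 + ε) ^ 2 with hk
  have hk1 : 1 < k := by nlinarith
  have hαk : 2 * k * α' = (k - 1) * α := by
    rw [hα']
    field_simp
  have hα'0 : 0 < α' := by
    rw [hα']
    have : 0 < k - 1 := by linarith
    positivity
  have hα'2 : 2 * α' ≤ α := by nlinarith
  have hkey : α' * (1 + k) = (k - 1) * (α - α') := by linarith
  obtain ⟨t, ht, hβ⟩ := exists_translate_le_dist V (β := α - α') (by linarith) (by linarith) hV q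
  obtain ⟨i₀, hi₀⟩ := Finite.exists_min fun i => dist (V i + t) q
  set m := dist (V i₀ + t) q with hm
  refine ⟨fun i => V i + t, (1 + ε) * (m - α') + δ, fun i j hij => ?_, ?_, ?_⟩
  · rw [dist_add_right, hV i j hij]
  · rintro x ⟨i, hi⟩
    refine ⟨i, (dist_triangle x (V i + t) (V i)).trans ?_⟩
    have : dist (V i + t) (V i) = ‖t‖ := by simp [dist_eq_norm]
    linarith
  · rintro x ⟨i, hi⟩
    have hlow : m - α' ≤ dist x q := by
      have := dist_triangle_left (V i + t) q x
      have := hi₀ i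
      linarith
    have hup : dist x q ≤ α' + ((2 + ε) * δ + m) := by
      have h1 := dist_triangle x (V i + t) q
      have h2 := dist_triangle (V i + t) (V i₀ + t) q
      have h3 : dist (V i + t) (V i₀ + t) ≤ (2 + ε) * δ := by
        rw [dist_add_right]
        rcases eq_or_ne i i₀ with rfl | h
        · rw [dist_self]
          positivity
        · exact (hV i i₀ h).le
      linarith
    have hmβ : (k - 1) * (α - α') ≤ (k - 1) * m :=
      mul_le_mul_of_nonneg_left (hβ i₀) (by linarith)
    have hr : (1 + ε) * ((1 + ε) * (m - α') + δ) + δ = k * (m - α') + (2 + ε) * δ := by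
      rw [hk]
      ring
    constructor
    · linarith
    · gcongr
end

section
/- Let n ≥ 2, δ > 0, and let Δ ⊆ ℝⁿ be a regular simplex of edge length 2δ. Let α satisfy 0 < α < δ/4, let q ∈ ℝⁿ be any point, and set α' := α²/(162·δ). Then there exist a regular simplex Δ' ⊆ ℝⁿ of edge length 2δ and a response r ∈ ℝ such that Δ'_{α'} ⊆ Δ_α and every x ∈ Δ'_{α'} satisfies |dist(x,q) − r| ≤ δ. -/
section SimplexPerturbation

variable {E : Type*} [NormedAddCommGroup E] [InnerProductSpace ℝ E]

/-- Bessel's inequality for two orthogonal vectors, the first one of norm one. -/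
theorem inner_sq_le_of_orthogonal {e w : E} (he : ‖e‖ = 1) (hew : inner ℝ e w = 0) (x : E) :
    inner ℝ w x ^ 2 ≤ ‖w‖ ^ 2 * (‖x‖ ^ 2 - inner ℝ e x ^ 2) := by
  have h1 : inner ℝ w (x - inner ℝ e x • e) = inner ℝ w x := by
    rw [inner_sub_right, inner_smul_right, real_inner_comm e w, hew]; ring
  have h2 : ‖x - inner ℝ e x • e‖ ^ 2 = ‖x‖ ^ 2 - inner ℝ e x ^ 2 := by
    rw [norm_sub_sq_real, inner_smul_right, norm_smul, he, real_inner_comm e x, mul_one,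
      Real.norm_eq_abs, sq_abs]
    ring
  rw [← h1, ← h2, ← mul_pow]
  exact sq_le_sq.2 ((abs_real_inner_le_norm _ _).trans (le_abs_self _))

/-- The rotation in the oriented plane spanned by the orthonormal pair `e, f` by the angle with
cosine `c` and sine `s`. -/
noncomputable def planeRotation (e f : E) (c s : ℝ) (x : E) : E :=
  x + (((c - 1) * inner ℝ e x - s * inner ℝ f x) • e +
    (s * inner ℝ e x + (c - 1) * inner ℝ f x) • f)

theorem planeRotation_sub (e f : E) (c s : ℝ) (x y : E) :
    planeRotation e f c s (x - y) = planeRotation e f c s x - planeRotation e f c s y := by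
  simp only [planeRotation, inner_sub_right]
  module

theorem norm_sq_smul_add_smul {e f : E} (he : ‖e‖ = 1) (hf : ‖f‖ = 1) (hef : inner ℝ e f = 0)
    (a b : ℝ) : ‖a • e + b • f‖ ^ 2 = a ^ 2 + b ^ 2 := by
  rw [norm_add_sq_real, norm_smul, norm_smul, real_inner_smul_left, real_inner_smul_right, he, hf,
    hef, mul_one, mul_one, Real.norm_eq_abs, Real.norm_eq_abs, sq_abs, sq_abs]
  ring

theorem norm_planeRotation {e f : E} (he : ‖e‖ = 1) (hf : ‖f‖ = 1) (hef : inner ℝ e f = 0)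
    {c s : ℝ} (hcs : c ^ 2 + s ^ 2 = 1) (x : E) : ‖planeRotation e f c s x‖ = ‖x‖ := by
  rw [← sq_eq_sq₀ (norm_nonneg _) (norm_nonneg _), planeRotation, norm_add_sq_real,
    norm_sq_smul_add_smul he hf hef, inner_add_right, real_inner_smul_right,
    real_inner_smul_right, real_inner_comm e x, real_inner_comm f x]
  linear_combination (inner ℝ e x ^ 2 + inner ℝ f x ^ 2) * hcs

theorem norm_planeRotation_sub_self_sq_le {e f : E} (he : ‖e‖ = 1) (hf : ‖f‖ = 1)
    (hef : inner ℝ e f = 0) {c s : ℝ} (hcs : c ^ 2 + s ^ 2 = 1) (x : E) :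
    ‖planeRotation e f c s x - x‖ ^ 2 ≤ (2 - 2 * c) * ‖x‖ ^ 2 := by
  have h := inner_sq_le_of_orthogonal he hef x
  rw [hf] at h
  have hc : 0 ≤ 2 - 2 * c := by nlinarith [sq_nonneg s]
  rw [planeRotation, add_sub_cancel_left, norm_sq_smul_add_smul he hf hef]
  calc _ = (2 - 2 * c) * (inner ℝ e x ^ 2 + inner ℝ f x ^ 2) := by
        linear_combination (inner ℝ e x ^ 2 + inner ℝ f x ^ 2) * hcs
    _ ≤ _ := by gcongr; linarith

theorem planeRotation_smul_left {e f : E} (he : ‖e‖ = 1) (hef : inner ℝ e f = 0) (c s t : ℝ) :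
    planeRotation e f c s (t • e) = (t * c) • e + (t * s) • f := by
  have h1 : inner ℝ e e = 1 := by rw [real_inner_self_eq_norm_sq, he]; norm_num
  rw [planeRotation, real_inner_smul_right, real_inner_smul_right, h1, real_inner_comm e f, hef]
  module

theorem norm_add_le_of_inner_le {v z : E} {ε : ℝ} (hε : ε ≤ 1) (hv : ‖v‖ = 2)
    (h : inner ℝ v z ≤ 2 * (‖z‖ - ε * (2 + ‖z‖))) : ‖v + z‖ ≤ ‖z‖ + (2 - 2 * ε) := by
  refine le_of_sq_le_sq ?_ (by linarith [norm_nonneg z])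
  rw [norm_add_sq_real, hv]
  nlinarith [sq_nonneg ε]

set_option maxHeartbeats 2000000 in
/-- A family of points at mutual distance `2`, with at least three members, can be moved by at most
`9α/10` into a congruent family whose distances from `q` differ by at most `2 - α²/81`. -/
theorem exists_congruent_dist_le {ι : Type*} (p : ι → E)
    (hp : ∀ i j, i ≠ j → dist (p i) (p j) = 2) (hι : ∀ a b : ι, ∃ c, c ≠ a ∧ c ≠ b)
    (q : E) {α : ℝ} (hα0 : 0 < α) (hα : α < 1 / 4) :
    ∃ p' : ι → E, (∀ i j, i ≠ j → dist (p' i) (p' j) = 2) ∧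
      (∀ i, dist (p' i) (p i) ≤ 9 / 10 * α) ∧
      ∀ i j, dist (p' i) q ≤ dist (p' j) q + (2 - 2 * (α ^ 2 / 162)) := by
  obtain ⟨ε, hε⟩ : ∃ ε, ε = α ^ 2 / 162 := ⟨_, rfl⟩
  rw [← hε]
  have hε0 : 0 < ε := by rw [hε]; positivity
  have hε1 : ε ≤ 1 / 2592 := by rw [hε]; nlinarith
  by_cases hgood : ∀ i j, dist (p i) q ≤ dist (p j) q + (2 - 2 * ε)
  · exact ⟨p, hp, fun i => by rw [dist_self]; positivity, hgood⟩
  push Not at hgood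
  obtain ⟨a, b, hab⟩ := hgood
  have hne : a ≠ b := by rintro rfl; linarith
  obtain ⟨c, hca, hcb⟩ := hι a b
  obtain ⟨v, hv⟩ : ∃ v : ι → E, ∀ i, v i = p i - p b := ⟨_, fun _ => rfl⟩
  obtain ⟨z, hz⟩ : ∃ z, z = p b - q := ⟨_, rfl⟩
  have hdist : ∀ i, dist (p i) q = ‖v i + z‖ := fun i => by
    rw [dist_eq_norm, hv, hz, sub_add_sub_cancel]
  have hvb : v b = 0 := by rw [hv, sub_self]
  have hvn : ∀ i, i ≠ b → ‖v i‖ = 2 := fun i hi => by rw [hv, ← dist_eq_norm, hp i b hi]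
  have hvv : ∀ i j, i ≠ b → j ≠ b → i ≠ j → inner ℝ (v i) (v j) = 2 := fun i j hi hj hij => by
    have h : ‖v i - v j‖ = 2 := by
      rw [hv, hv, sub_sub_sub_cancel_right, ← dist_eq_norm, hp i j hij]
    have h2 := norm_sub_sq_real (v i) (v j)
    rw [h, hvn i hi, hvn j hj] at h2
    linarith
  obtain ⟨e, hea⟩ : ∃ e, v a = (2 : ℝ) • e := ⟨(1 / 2 : ℝ) • v a, by module⟩
  have he : ‖e‖ = 1 := by
    have := hvn a hne
    rw [hea, norm_smul] at this
    norm_num at this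
    exact this
  have hev : ∀ i, i ≠ a → i ≠ b → inner ℝ e (v i) = 1 := fun i hia hib => by
    have := hvv a i hne hib hia.symm
    rw [hea, real_inner_smul_left] at this
    linarith
  obtain ⟨x, hx⟩ : ∃ x, x = inner ℝ e z := ⟨_, rfl⟩
  obtain ⟨ρ, hρ⟩ : ∃ ρ, ρ = ‖z‖ := ⟨_, rfl⟩
  have hρ0 : 0 ≤ ρ := hρ ▸ norm_nonneg z
  have hxρ : x ≤ ρ := by
    have := real_inner_le_norm e z
    rw [he, one_mul] at this
    rwa [hx, hρ]
  have hbdist : dist (p b) q = ρ := by rw [hdist, hvb, zero_add, hρ]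
  rw [hbdist, hdist] at hab
  have hbad : ρ - x < ε * (2 + ρ) := by
    by_contra! hcon
    refine absurd (norm_add_le_of_inner_le (v := v a) (z := z) (ε := ε) (by linarith)
      (hvn a hne) ?_) (by rw [← hρ]; linarith)
    rw [hea, real_inner_smul_left, ← hx, ← hρ]
    linarith
  have hy : ρ ^ 2 - x ^ 2 ≤ 2 * ρ * (ε * (2 + ρ)) := by nlinarith
  have hproj : ∀ w : E, inner ℝ e w = 0 →
      inner ℝ w z ^ 2 ≤ ‖w‖ ^ 2 * (2 * ρ * (ε * (2 + ρ))) := fun w hw => by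
    refine (inner_sq_le_of_orthogonal he hw z).trans ?_
    rw [← hx, ← hρ]
    gcongr
  have hinner : ∀ i, i ≠ a → i ≠ b →
      (inner ℝ (v i) z - x) ^ 2 ≤ 6 * ρ * (ε * (2 + ρ)) := fun i hia hib => by
    have hee : inner ℝ e e = 1 := by rw [real_inner_self_eq_norm_sq, he]; norm_num
    have h := hproj (v i - e) (by rw [inner_sub_right, hev i hia hib, hee, sub_self])
    rw [norm_sub_sq_real, real_inner_comm e, hev i hia hib, hvn i hib, he, inner_sub_left,
      ← hx] at h
    linarith
  have hinner' : ∀ i, i ≠ a → i ≠ b →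
      |inner ℝ (v i) z - x| ≤ 1 / 20 * (1 + ρ) := fun i hia hib => by
    refine abs_le_of_sq_le_sq ((hinner i hia hib).trans ?_) (by positivity)
    nlinarith [mul_le_mul_of_nonneg_right hε1 (show 0 ≤ ρ * (2 + ρ) by positivity)]
  have hxlow : ρ - 1 / 1296 * (1 + ρ) ≤ x := by nlinarith
  have hupper : ∀ i, dist (p i) q ≤ ρ + 2 := fun i => by
    rcases eq_or_ne i b with rfl | hib
    · linarith
    · rw [hdist, hρ, add_comm, ← hvn i hib]; exact norm_add_le _ _
  have hlower : ∀ i, i ≠ b → ρ + 9 / 10 ≤ dist (p i) q := fun i hib => by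
    rcases eq_or_ne i a with rfl | hia
    · rw [hdist]; linarith
    · rw [hdist]
      refine le_of_sq_le_sq ?_ (norm_nonneg _)
      rw [norm_add_sq_real, hvn i hib, ← hρ]
      have := (abs_le.1 (hinner' i hia hib)).1
      nlinarith
  -- Only the pairs involving `b` are sensitive to a small perturbation.
  suffices H : ∃ p' : ι → E, (∀ i j, i ≠ j → dist (p' i) (p' j) = 2) ∧
      (∀ i, dist (p' i) (p i) ≤ 9 / 10 * α) ∧
      ∀ i, i ≠ b → dist (p' i) q ≤ dist (p' b) q + (2 - 2 * ε) by
    obtain ⟨p', h1, h2, h3⟩ := H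
    refine ⟨p', h1, h2, fun i j => ?_⟩
    rcases eq_or_ne j b with rfl | hjb
    · rcases eq_or_ne i j with rfl | hij
      · linarith
      · exact h3 i hij
    · have t1 := dist_triangle (p' i) (p i) q
      have t2 := dist_triangle (p j) (p' j) q
      rw [dist_comm (p j) (p' j)] at t2
      linarith [h2 i, h2 j, hupper i, hlower j hjb]
  obtain ⟨u, hu1, hue, huv⟩ : ∃ u : E, ‖u‖ = 1 ∧ inner ℝ e u = 0 ∧
      ∀ i, i ≠ a → i ≠ b → inner ℝ (v i) u ≤ -(1 / 2) := by
    have h3 : (0 : ℝ) < √3 := by positivity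
    have hsq : √3 ^ 2 = 3 := Real.sq_sqrt (by norm_num)
    have hee : inner ℝ e e = 1 := by rw [real_inner_self_eq_norm_sq, he]; norm_num
    refine ⟨(√3)⁻¹ • (e - v c), ?_, ?_, fun i hia hib => ?_⟩
    · have : ‖e - v c‖ = √3 := by
        rw [← sq_eq_sq₀ (norm_nonneg _) h3.le, hsq, norm_sub_sq_real, he, hvn c hcb,
          hev c hca hcb]
        norm_num
      rw [norm_smul, this, norm_inv, Real.norm_of_nonneg h3.le, inv_mul_cancel₀ h3.ne']
    · rw [inner_smul_right, inner_sub_right, hee, hev c hca hcb, sub_self, mul_zero]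
    · rw [inner_smul_right, inner_sub_right, real_inner_comm e, hev i hia hib]
      have hic : 2 ≤ inner ℝ (v i) (v c) := by
        rcases eq_or_ne i c with rfl | hic
        · rw [real_inner_self_eq_norm_sq, hvn i hib]; norm_num
        · exact (hvv i c hib hcb hic).ge
      have h2 : 1 / 2 ≤ (√3)⁻¹ := by
        rw [one_div]
        exact inv_anti₀ h3 (by nlinarith)
      nlinarith
  rcases le_total ρ 1 with hρ1 | hρ1
  · -- `q` is close to `p b`: translate
    obtain ⟨t, ht⟩ : ∃ t, t = 4 / 5 * α := ⟨_, rfl⟩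
    have htn : ‖t • u‖ = t := by
      rw [norm_smul, hu1, mul_one, Real.norm_of_nonneg (by rw [ht]; positivity)]
    obtain ⟨y, hydef⟩ : ∃ y, y = z + t • u := ⟨_, rfl⟩
    have hydist : ∀ i, dist (p i + t • u) q = ‖v i + y‖ := fun i => by
      rw [dist_eq_norm, hv, hydef, hz]; congr 1; abel
    have hyn : ‖y‖ ≤ 6 / 5 := by
      rw [hydef]
      refine (norm_add_le _ _).trans ?_
      rw [htn, ← hρ]; linarith
    have hey : inner ℝ e y = x := by
      rw [hydef, inner_add_right, inner_smul_right, hue, ← hx]; ring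
    have hcoef : ρ * (ε * (2 + ρ)) ≤ 3 * ε := by nlinarith
    have huy : 3 / 5 * α ≤ inner ℝ u y := by
      have h := hproj u hue
      rw [hu1] at h
      have h' : |inner ℝ u z| ≤ 1 / 5 * α := by
        refine abs_le_of_sq_le_sq ?_ (by positivity)
        nlinarith
      rw [hydef, inner_add_right, inner_smul_right, real_inner_self_eq_norm_sq, hu1]
      linarith [(abs_le.1 h').1]
    have hpyth : x ^ 2 + (3 / 5 * α) ^ 2 ≤ ‖y‖ ^ 2 := by
      have h := inner_sq_le_of_orthogonal he hue y
      rw [hu1, hey] at h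
      nlinarith
    have hypos : 3 / 5 * α ≤ ‖y‖ := le_of_sq_le_sq (by nlinarith [sq_nonneg x]) (norm_nonneg _)
    have hxy : x ≤ ‖y‖ := le_of_sq_le_sq (by nlinarith [sq_nonneg α]) (norm_nonneg _)
    refine ⟨fun i => p i + t • u, fun i j hij => by rw [dist_add_right, hp i j hij],
      fun i => by rw [dist_eq_norm, add_sub_cancel_left, htn]; linarith, fun i hib => ?_⟩
    rw [hydist, hydist, hvb, zero_add]
    refine norm_add_le_of_inner_le (by linarith) (hvn i hib) ?_
    rcases eq_or_ne i a with rfl | hia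
    · rw [hea, real_inner_smul_left, hey]
      have h1 : (‖y‖ - x) * (12 / 5) ≥ (3 / 5 * α) ^ 2 := by nlinarith
      nlinarith
    · have h1 : inner ℝ (v i) z - x ≤ 1 / 3 * α := by
        refine le_of_sq_le_sq ((hinner i hia hib).trans ?_) (by positivity)
        nlinarith
      have h2 : inner ℝ (v i) y ≤ x := by
        rw [hydef, inner_add_right, inner_smul_right]
        nlinarith [huv i hia hib]
      nlinarith
  · -- `q` is away from `p b`: rotate about `p b`
    obtain ⟨f, hf1, hfe, hfz⟩ : ∃ f : E, ‖f‖ = 1 ∧ inner ℝ e f = 0 ∧ inner ℝ f z ≤ 0 := by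
      rcases le_total (inner ℝ u z) 0 with h | h
      · exact ⟨u, hu1, hue, h⟩
      · exact ⟨-u, by rw [norm_neg, hu1], by rw [inner_neg_right, hue, neg_zero],
          by rw [inner_neg_left]; linarith⟩
    obtain ⟨k, hk⟩ : ∃ k, k = 1 - α ^ 2 / 50 := ⟨_, rfl⟩
    have hk0 : 0 ≤ k := by rw [hk]; nlinarith
    have hk1 : k ≤ 1 := by rw [hk]; linarith [sq_nonneg α]
    obtain ⟨s, hs0, hs⟩ : ∃ s, 0 ≤ s ∧ k ^ 2 + s ^ 2 = 1 :=
      ⟨√(1 - k ^ 2), Real.sqrt_nonneg _, by rw [Real.sq_sqrt (by nlinarith)]; ring⟩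
    have hmove : ∀ i, dist (p b + planeRotation e f k s (v i)) (p i) ≤ 2 / 5 * α := fun i => by
      have hpi : p i = p b + v i := by rw [hv]; abel
      rw [hpi, dist_add_left, dist_eq_norm]
      refine le_of_sq_le_sq
        ((norm_planeRotation_sub_self_sq_le he hf1 hfe hs (v i)).trans ?_) (by positivity)
      have hvi : ‖v i‖ ^ 2 ≤ 4 := by
        rcases eq_or_ne i b with rfl | hib
        · rw [hvb, norm_zero]; norm_num
        · rw [hvn i hib]; norm_num
      rw [hk]
      nlinarith [mul_le_mul_of_nonneg_left hvi (sq_nonneg α)]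
    have hbfix : p b + planeRotation e f k s (v b) = p b := by
      rw [hvb]; simp [planeRotation]
    refine ⟨fun i => p b + planeRotation e f k s (v i), fun i j hij => ?_,
      fun i => (hmove i).trans (by linarith), fun i hib => ?_⟩
    · rw [dist_add_left, dist_eq_norm, ← planeRotation_sub, norm_planeRotation he hf1 hfe hs,
        hv, hv, sub_sub_sub_cancel_right, ← dist_eq_norm, hp i j hij]
    · simp only [hbfix]
      rcases eq_or_ne i a with rfl | hia
      · have h1 : dist (p b + planeRotation e f k s (v i)) q
            = ‖planeRotation e f k s (v i) + z‖ := by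
          rw [dist_eq_norm, hz]; congr 1; abel
        rw [h1, hbdist, hρ]
        refine norm_add_le_of_inner_le (by linarith)
          (by rw [norm_planeRotation he hf1 hfe hs, hvn i hib]) ?_
        rw [hea, planeRotation_smul_left he hfe, inner_add_left, real_inner_smul_left,
          real_inner_smul_left, ← hx, ← hρ]
        have h2 : s * inner ℝ f z ≤ 0 := mul_nonpos_of_nonneg_of_nonpos hs0 hfz
        have h3 : k * x ≤ k * ρ := by gcongr
        have h4 : ε * (2 + ρ) ≤ 3 * ε * ρ := by nlinarith
        have h5 : 3 * ε * ρ ≤ (1 - k) * ρ := by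
          gcongr
          rw [hε, hk]; linarith [sq_nonneg α]
        linarith
      · have h1 : dist (p i) q ≤ ρ + 17 / 10 := by
          rw [hdist]
          refine le_of_sq_le_sq ?_ (by positivity)
          rw [norm_add_sq_real, hvn i hib, ← hρ]
          have := (abs_le.1 (hinner' i hia hib)).2
          nlinarith
        have h2 := dist_triangle (p b + planeRotation e f k s (v i)) (p i) q
        rw [hbdist]
        linarith [hmove i]

end SimplexPerturbation

/-- Let `n ≥ 2`, `δ > 0`, and let `Δ ⊆ ℝⁿ` be a regular simplex with
vertices `V 0, …, V n` pairwise at distance `2δ`.  Let `0 < α < δ/4`, let `q ∈ ℝⁿ`, and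
set `α' := α²/(162·δ)`.  Then there are a regular simplex `Δ'` of edge length `2δ`
(with vertices `V'`) and a response `r ∈ ℝ` such that `Δ'_{α'} ⊆ Δ_α` and every
`x ∈ Δ'_{α'}` satisfies `|dist(x,q) − r| ≤ δ`. -/
theorem stmt16 (n : ℕ) (hn : 2 ≤ n) (δ : ℝ) (hδ : 0 < δ)
    (V : Fin (n + 1) → EuclideanSpace ℝ (Fin n))
    (hV : ∀ i j, i ≠ j → dist (V i) (V j) = 2 * δ)
    (α : ℝ) (hα0 : 0 < α) (hα : α < δ / 4)
    (q : EuclideanSpace ℝ (Fin n))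
    (α' : ℝ) (hα' : α' = α ^ 2 / (162 * δ)) :
    ∃ (V' : Fin (n + 1) → EuclideanSpace ℝ (Fin n)) (r : ℝ),
      (∀ i j, i ≠ j → dist (V' i) (V' j) = 2 * δ) ∧
      (∀ x : EuclideanSpace ℝ (Fin n),
        (∃ i, dist x (V' i) ≤ α') → (∃ i, dist x (V i) ≤ α)) ∧
      (∀ x : EuclideanSpace ℝ (Fin n), (∃ i, dist x (V' i) ≤ α') →
        |dist x q - r| ≤ δ) := by
  obtain ⟨p, hp⟩ : ∃ p : Fin (n + 1) → EuclideanSpace ℝ (Fin n), ∀ i, V i = δ • p i :=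
    ⟨fun i => δ⁻¹ • V i, fun i => by rw [smul_inv_smul₀ hδ.ne']⟩
  obtain ⟨q₀, hq⟩ : ∃ q₀ : EuclideanSpace ℝ (Fin n), q = δ • q₀ :=
    ⟨δ⁻¹ • q, by rw [smul_inv_smul₀ hδ.ne']⟩
  obtain ⟨β, hβ⟩ : ∃ β, α = δ * β := ⟨α / δ, by field_simp⟩
  have hscale : ∀ x y : EuclideanSpace ℝ (Fin n), dist (δ • x) (δ • y) = δ * dist x y :=
    fun x y => by rw [dist_smul₀, Real.norm_of_nonneg hδ.le]
  have hβ0 : 0 < β := by rw [hβ] at hα0; exact pos_of_mul_pos_right hα0 hδ.le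
  have hβ1 : β < 1 / 4 := by rw [hβ] at hα; nlinarith
  have hε : α' = δ * (β ^ 2 / 162) := by rw [hα', hβ]; field_simp
  obtain ⟨p', h1, h2, h3⟩ := exists_congruent_dist_le p
    (fun i j hij => by
      have := hV i j hij
      rw [hp, hp, hscale] at this
      exact mul_left_cancel₀ hδ.ne' (by linarith))
    (fun a b => by
      obtain ⟨c, hc⟩ := Finset.exists_mem_notMem_of_card_lt_card
        (s := ({a, b} : Finset (Fin (n + 1)))) (t := Finset.univ)
        ((Finset.card_le_two).trans_lt (by rw [Finset.card_univ, Fintype.card_fin]; omega))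
      exact ⟨c, by simpa using hc⟩)
    q₀ hβ0 hβ1
  obtain ⟨m, hm⟩ := Finite.exists_max fun i => dist (δ • p' i) q
  have hspread : ∀ i j, dist (δ • p' i) q ≤ dist (δ • p' j) q + (2 * δ - 2 * α') := fun i j => by
    rw [hq, hscale, hscale, hε]
    nlinarith [h3 i j]
  refine ⟨fun i => δ • p' i, dist (δ • p' m) q + α' - δ,
    fun i j hij => by rw [hscale, h1 i j hij, mul_comm], ?_, ?_⟩
  · rintro x ⟨i, hi⟩
    refine ⟨i, (dist_triangle x (δ • p' i) (V i)).trans ?_⟩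
    have hmove : dist (δ • p' i) (V i) ≤ δ * (9 / 10 * β) := by
      rw [hp, hscale]
      gcongr
      exact h2 i
    have hsmall : β ^ 2 / 162 ≤ 1 / 10 * β := by nlinarith
    have := mul_le_mul_of_nonneg_left hsmall hδ.le
    rw [hβ]
    linarith
  · rintro x ⟨i, hi⟩
    have t1 := dist_triangle x (δ • p' i) q
    have t2 := dist_triangle (δ • p' i) x q
    rw [dist_comm (δ • p' i) x] at t2
    rw [abs_le]
    constructor <;> linarith [hm i, hspread m i]
end

section
/- Let δ ≥ 0 and let q₁, q₂, r₁, r₂ ∈ ℝ with |q₂ − q₁| > 2δ. If two real numbers x and y satisfy ||x − qᵢ| − rᵢ| ≤ δ and ||y − qᵢ| − rᵢ| ≤ δ for both i = 1 and i = 2, then |x − y| ≤ 2δ. -/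
/-- If the distances of two reals from `q` agree up to `ε`, then the two reals agree up to `ε`,
or their sum agrees with `2 * q` up to `ε`. -/
theorem abs_sub_le_or_abs_add_sub_two_mul_le {x y q ε : ℝ} (h : |(|x - q| - |y - q|)| ≤ ε) :
    |x - y| ≤ ε ∨ |x + y - 2 * q| ≤ ε := by
  grind

/-- Let `δ ≥ 0` and `q₁, q₂, r₁, r₂ ∈ ℝ` with `|q₂ − q₁| > 2δ`.  If
`x, y ∈ ℝ` satisfy `||x − qᵢ| − rᵢ| ≤ δ` and `||y − qᵢ| − rᵢ| ≤ δ` for `i = 1, 2`, then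
`|x − y| ≤ 2δ`. -/
theorem stmt17 (δ q₁ q₂ r₁ r₂ : ℝ) (hδ : 0 ≤ δ) (hq : 2 * δ < |q₂ - q₁|)
    (x y : ℝ)
    (hx1 : |(|x - q₁| - r₁)| ≤ δ) (hx2 : |(|x - q₂| - r₂)| ≤ δ)
    (hy1 : |(|y - q₁| - r₁)| ≤ δ) (hy2 : |(|y - q₂| - r₂)| ≤ δ) :
    |x - y| ≤ 2 * δ := by
  have h₁ : |(|x - q₁| - |y - q₁|)| ≤ 2 * δ := by
    rw [abs_le] at *
    constructor <;> linarith
  have h₂ : |(|x - q₂| - |y - q₂|)| ≤ 2 * δ := by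
    rw [abs_le] at *
    constructor <;> linarith
  rcases abs_sub_le_or_abs_add_sub_two_mul_le h₁ with h | h₁
  · exact h
  rcases abs_sub_le_or_abs_add_sub_two_mul_le h₂ with h | h₂
  · exact h
  refine absurd hq (not_lt.mpr ?_)
  rw [abs_le] at h₁ h₂ ⊢
  constructor <;> linarith
end

section
/- Let n ≥ 1, d > 0 and α > 0, and let Δ ⊆ ℝⁿ be a regular simplex of edge length d. Then the α-neighborhood Δ_α contains a regular simplex of edge length d + √(2(n+1)/n) · α; that is, there exist n+1 points in ℝⁿ that are pairwise at distance d + √(2(n+1)/n) · α, each lying within distance α of some vertex of Δ. -/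
/-- In a family of `n + 1` points pairwise at distance `d`, the sum of the vectors joining
all points to a fixed one has squared norm `n (n + 1) d² / 2`. -/
theorem norm_sq_sum_sub_of_pairwise_dist_eq {E : Type*} [NormedAddCommGroup E]
    [InnerProductSpace ℝ E] {n : ℕ} {d : ℝ} {V : Fin (n + 1) → E}
    (hV : ∀ i j, i ≠ j → dist (V i) (V j) = d) (i : Fin (n + 1)) :
    ‖∑ j, (V i - V j)‖ ^ 2 = n * (n + 1) * d ^ 2 / 2 := by
  have norm_sq (a b : Fin (n + 1)) : ‖V a - V b‖ ^ 2 = d ^ 2 - if a = b then d ^ 2 else 0 := by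
    split_ifs with h
    · simp [h]
    · rw [← dist_eq_norm, hV a b h, sub_zero]
  have inner_eq (j k : Fin (n + 1)) : inner ℝ (V i - V j) (V i - V k) =
      (‖V i - V j‖ ^ 2 + ‖V i - V k‖ ^ 2 - ‖V k - V j‖ ^ 2) / 2 := by
    have h := norm_sub_sq_real (V i - V j) (V i - V k)
    rw [sub_sub_sub_cancel_left] at h
    linarith
  rw [← real_inner_self_eq_norm_sq, sum_inner]
  simp only [inner_sum, inner_eq, norm_sq]
  simp only [← Finset.sum_div, ← Finset.mul_sum, Finset.sum_add_distrib,
    Finset.sum_sub_distrib, Finset.sum_ite_eq, Finset.sum_ite_eq', Finset.mem_univ, if_true,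
    Finset.sum_const, Finset.card_univ, Fintype.card_fin, nsmul_eq_mul]
  push_cast
  ring

/-- Let `n ≥ 1`, `d > 0`, `α > 0`, and let `Δ ⊆ ℝⁿ` be a regular
simplex with vertices `V 0, …, V n` pairwise at distance `d`.  Then the
`α`-neighborhood of `Δ` contains a regular simplex of edge length
`d + √(2(n+1)/n) · α`: there are `n+1` points `W 0, …, W n` pairwise at that distance,
each within distance `α` of some vertex of `Δ`. -/
theorem stmt18 (n : ℕ) (hn : 1 ≤ n) (d α : ℝ) (hd : 0 < d) (hα : 0 < α)
    (V : Fin (n + 1) → EuclideanSpace ℝ (Fin n))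
    (hV : ∀ i j, i ≠ j → dist (V i) (V j) = d) :
    ∃ W : Fin (n + 1) → EuclideanSpace ℝ (Fin n),
      (∀ i j, i ≠ j →
        dist (W i) (W j) = d + Real.sqrt (2 * ((n : ℝ) + 1) / (n : ℝ)) * α) ∧
      (∀ i, ∃ j, dist (W i) (V j) ≤ α) := by
  have hn' : (0 : ℝ) < n := by exact_mod_cast hn
  set s := Real.sqrt (2 * ((n : ℝ) + 1) / (n : ℝ))
  have hs0 : 0 ≤ s := Real.sqrt_nonneg _
  have hs2 : s ^ 2 = 2 * ((n : ℝ) + 1) / n := Real.sq_sqrt (by positivity)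
  set t := s * α / (d * (n + 1)) with ht
  have ht0 : 0 ≤ t := by positivity
  refine ⟨fun i => V i + t • ∑ j, (V i - V j), fun i j hij => ?_, fun i => ⟨i, ?_⟩⟩
  · have hsub : (V i + t • ∑ k, (V i - V k)) - (V j + t • ∑ k, (V j - V k)) =
        (1 + t * (n + 1)) • (V i - V j) := by
      simp only [Finset.sum_sub_distrib, Finset.sum_const, Finset.card_univ, Fintype.card_fin,
        ← Nat.cast_smul_eq_nsmul ℝ]
      push_cast
      module
    rw [dist_eq_norm, hsub, norm_smul, ← dist_eq_norm, hV i j hij,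
      Real.norm_of_nonneg (by positivity), ht]
    field_simp
  · rw [dist_eq_norm, add_sub_cancel_left, norm_smul, Real.norm_of_nonneg ht0]
    refine pow_le_pow_iff_left₀ (by positivity) hα.le two_ne_zero |>.mp ?_
    rw [mul_pow, norm_sq_sum_sub_of_pairwise_dist_eq hV i, ht, div_pow, mul_pow, hs2]
    apply le_of_eq
    field_simp
end
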